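/- arXiv:2511.20838 — 7 statements merged into one kernel-verified Lean document; each statement's English description precedes it below -/
import Mathlib

section
/- Let n, m, p be positive integers, let f : ℝⁿ → ℝⁿ, Ḡ : ℝⁿ → ℝ^{n×m}, h : ℝⁿ → ℝᵖ, J̄ : ℝⁿ → ℝ^{p×m} be continuous, let Q ∈ ℝ^{p×p} be symmetric and negative definite, S ∈ ℝ^{p×m}, and R ∈ ℝ^{m×m} symmetric. Let Ω ⊆ ℝⁿ, let V : ℝⁿ → ℝ be continuously differentiable with V(x) ≥ 0 for all x ∈ Ω, and suppose that for every x ∈ Ω the symmetric (1+m+p)×(1+m+p) block matrix M(x) = [[∇V(x)ᵀf(x), ½Ḡ(x)ᵀ∇V(x) − Sᵀh(x), h(x)ᵀ], [∗, −R − SᵀJ̄(x) − J̄(x)ᵀS, J̄(x)ᵀ], [∗, ∗, Q⁻¹]] (written row-wise with symmetric completion) is negative semidefinite. Then for every t₀ ≤ t₁, every continuous input u : [t₀,t₁] → ℝ^m, and every differentiable trajectory x : [t₀,t₁] → ℝⁿ satisfying x(t) ∈ Ω and x′(t) = f(x(t)) + Ḡ(x(t))u(t) for all t ∈ [t₀,t₁],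 setting y(t) = h(x(t)) + J̄(x(t))u(t) and w(t) = y(t)ᵀQy(t) + 2y(t)ᵀSu(t) + u(t)ᵀRu(t), one has V(x(t₀)) + ∫_{t₀}^{t₁} w(t) dt ≥ V(x(t₁)). -/
open Matrix

/-- The QSR Hamilton–Jacobi LMI block matrix
`M(x) = [[∇V(x)ᵀf(x), ½Ḡ(x)ᵀ∇V(x) − Sᵀh(x), h(x)ᵀ], [∗, −R − SᵀJ̄(x) − J̄(x)ᵀS, J̄(x)ᵀ], [∗, ∗, Q⁻¹]]`
built from the data `v = ∇V(x)`, `g = f(x)`, `h₀ = h(x)`, `G₀ = Ḡ(x)`, `J₀ = J̄(x)`. -/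
noncomputable def qsrM {n m p : ℕ}
    (v g : Fin n → ℝ) (h0 : Fin p → ℝ)
    (G0 : Matrix (Fin n) (Fin m) ℝ) (J0 : Matrix (Fin p) (Fin m) ℝ)
    (Q : Matrix (Fin p) (Fin p) ℝ) (S : Matrix (Fin p) (Fin m) ℝ)
    (R : Matrix (Fin m) (Fin m) ℝ) :
    Matrix (Unit ⊕ Fin m ⊕ Fin p) (Unit ⊕ Fin m ⊕ Fin p) ℝ :=
  Matrix.of fun i j =>
    match i, j with
    | Sum.inl _, Sum.inl _ => v ⬝ᵥ g
    | Sum.inl _, Sum.inr (Sum.inl k) => (1 / 2) * (G0ᵀ *ᵥ v) k - (Sᵀ *ᵥ h0) k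
    | Sum.inl _, Sum.inr (Sum.inr a) => h0 a
    | Sum.inr (Sum.inl k), Sum.inl _ => (1 / 2) * (G0ᵀ *ᵥ v) k - (Sᵀ *ᵥ h0) k
    | Sum.inr (Sum.inl k), Sum.inr (Sum.inl l) => (-R - Sᵀ * J0 - J0ᵀ * S) k l
    | Sum.inr (Sum.inl k), Sum.inr (Sum.inr a) => J0 a k
    | Sum.inr (Sum.inr a), Sum.inl _ => h0 a
    | Sum.inr (Sum.inr a), Sum.inr (Sum.inl k) => J0 a k
    | Sum.inr (Sum.inr a), Sum.inr (Sum.inr b) => Q⁻¹ a b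

/-- The quadratic form of `qsrM` at a vector whose first block is `1`. -/
theorem qsrM_dotProduct_mulVec {n m p : ℕ}
    (v g : Fin n → ℝ) (h0 : Fin p → ℝ)
    (G0 : Matrix (Fin n) (Fin m) ℝ) (J0 : Matrix (Fin p) (Fin m) ℝ)
    (Q : Matrix (Fin p) (Fin p) ℝ) (S : Matrix (Fin p) (Fin m) ℝ)
    (R : Matrix (Fin m) (Fin m) ℝ) (u : Fin m → ℝ) (q : Fin p → ℝ) :
    (Sum.elim (fun _ => 1) (Sum.elim u q)) ⬝ᵥ
        (qsrM v g h0 G0 J0 Q S R *ᵥ (Sum.elim (fun _ => 1) (Sum.elim u q))) =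
      v ⬝ᵥ (g + G0 *ᵥ u) - 2 * ((h0 + J0 *ᵥ u) ⬝ᵥ (S *ᵥ u)) - u ⬝ᵥ (R *ᵥ u)
        + 2 * (q ⬝ᵥ (h0 + J0 *ᵥ u)) + q ⬝ᵥ (Q⁻¹ *ᵥ q) := by
  have key : qsrM v g h0 G0 J0 Q S R *ᵥ (Sum.elim (fun _ => 1) (Sum.elim u q)) =
      Sum.elim
        (fun _ => v ⬝ᵥ g + (((1 / 2 : ℝ) • (G0ᵀ *ᵥ v) - Sᵀ *ᵥ h0) ⬝ᵥ u + h0 ⬝ᵥ q))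
        (Sum.elim
          ((1 / 2 : ℝ) • (G0ᵀ *ᵥ v) - Sᵀ *ᵥ h0 + ((-R - Sᵀ * J0 - J0ᵀ * S) *ᵥ u + J0ᵀ *ᵥ q))
          (h0 + (J0 *ᵥ u + Q⁻¹ *ᵥ q))) := by
    ext i
    rcases i with i | i | i <;>
      simp [qsrM, mulVec, dotProduct, Fintype.sum_sum_type]
  have transpose_dot : ∀ {k l : ℕ} (A : Matrix (Fin k) (Fin l) ℝ) (a : Fin k → ℝ)
      (b : Fin l → ℝ), b ⬝ᵥ (Aᵀ *ᵥ a) = a ⬝ᵥ (A *ᵥ b) := fun A a b => by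
    rw [mulVec_transpose, dotProduct_comm, dotProduct_mulVec]
  rw [key, sumElim_dotProduct_sumElim, sumElim_dotProduct_sumElim]
  have hone : ∀ c : ℝ, (fun _ : Unit => (1 : ℝ)) ⬝ᵥ (fun _ => c) = c := by simp [dotProduct]
  rw [hone, dotProduct_comm _ u]
  simp only [dotProduct_add, dotProduct_sub, dotProduct_smul, add_dotProduct, sub_mulVec,
    neg_mulVec, dotProduct_neg, ← mulVec_mulVec, transpose_dot, smul_eq_mul,
    dotProduct_comm q h0, dotProduct_comm (S *ᵥ u), dotProduct_comm q (J0 *ᵥ u)]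
  ring

/-- The differential dissipation inequality: negative semidefiniteness of `qsrM` bounds
`∇V ⬝ (f + G u)` by the supply rate. -/
theorem dotProduct_le_supply_of_posSemidef_neg_qsrM {n m p : ℕ}
    (v g : Fin n → ℝ) (h0 : Fin p → ℝ)
    (G0 : Matrix (Fin n) (Fin m) ℝ) (J0 : Matrix (Fin p) (Fin m) ℝ)
    (Q : Matrix (Fin p) (Fin p) ℝ) (hQ : IsUnit Q.det) (S : Matrix (Fin p) (Fin m) ℝ)
    (R : Matrix (Fin m) (Fin m) ℝ) (hM : (-(qsrM v g h0 G0 J0 Q S R)).PosSemidef)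
    (u : Fin m → ℝ) :
    v ⬝ᵥ (g + G0 *ᵥ u) ≤
      (h0 + J0 *ᵥ u) ⬝ᵥ (Q *ᵥ (h0 + J0 *ᵥ u)) + 2 * ((h0 + J0 *ᵥ u) ⬝ᵥ (S *ᵥ u)) +
        u ⬝ᵥ (R *ᵥ u) := by
  have h := hM.dotProduct_mulVec_nonneg
    (Sum.elim (fun _ => 1) (Sum.elim u (-(Q *ᵥ (h0 + J0 *ᵥ u)))))
  rw [star_trivial, neg_mulVec, dotProduct_neg, qsrM_dotProduct_mulVec] at h
  rw [mulVec_neg, mulVec_mulVec, nonsing_inv_mul _ hQ, one_mulVec, neg_dotProduct_neg,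
    neg_dotProduct, dotProduct_comm (Q *ᵥ _)] at h
  linarith

/-- Theorem 1 of the paper: if the QSR Hamilton–Jacobi LMI holds at every
point of `Ω` for a nonnegative continuously differentiable storage function `V`
(with gradient `gradV`), then along every trajectory of `ẋ = f(x) + Ḡ(x)u`,
`y = h(x) + J̄(x)u` remaining in `Ω`, the dissipation inequality
`V(x(t₀)) + ∫_{t₀}^{t₁} w(t) dt ≥ V(x(t₁))` holds, where
`w = yᵀQy + 2yᵀSu + uᵀRu`. -/
theorem qsr_lmi_implies_dissipation_inequality {n m p : ℕ}
    (hn : 0 < n) (hm : 0 < m) (hp : 0 < p)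
    (f : (Fin n → ℝ) → (Fin n → ℝ)) (hf : Continuous f)
    (Gb : (Fin n → ℝ) → Matrix (Fin n) (Fin m) ℝ) (hGb : Continuous Gb)
    (hfun : (Fin n → ℝ) → (Fin p → ℝ)) (hh : Continuous hfun)
    (Jb : (Fin n → ℝ) → Matrix (Fin p) (Fin m) ℝ) (hJb : Continuous Jb)
    (Q : Matrix (Fin p) (Fin p) ℝ) (hQsymm : Q.IsSymm) (hQneg : (-Q).PosDef)
    (S : Matrix (Fin p) (Fin m) ℝ)
    (R : Matrix (Fin m) (Fin m) ℝ) (hRsymm : R.IsSymm)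
    (Ω : Set (Fin n → ℝ))
    (V : (Fin n → ℝ) → ℝ)
    (gradV : (Fin n → ℝ) → (Fin n → ℝ))
    (DV : (Fin n → ℝ) → ((Fin n → ℝ) →L[ℝ] ℝ))
    (hV : ∀ pt, HasFDerivAt V (DV pt) pt)
    (hDV : ∀ pt w, DV pt w = gradV pt ⬝ᵥ w)
    (hgradV : Continuous gradV)
    (hVnonneg : ∀ x ∈ Ω, 0 ≤ V x)
    (hLMI : ∀ x ∈ Ω,
      (-(qsrM (gradV x) (f x) (hfun x) (Gb x) (Jb x) Q S R)).PosSemidef) :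
    ∀ (t₀ t₁ : ℝ), t₀ ≤ t₁ →
    ∀ u : ℝ → (Fin m → ℝ), ContinuousOn u (Set.Icc t₀ t₁) →
    ∀ x : ℝ → (Fin n → ℝ),
      (∀ t ∈ Set.Icc t₀ t₁, x t ∈ Ω) →
      (∀ t ∈ Set.Icc t₀ t₁, HasDerivAt x (f (x t) + (Gb (x t)) *ᵥ (u t)) t) →
      V (x t₁) ≤ V (x t₀) + ∫ t in t₀..t₁,
        ((hfun (x t) + (Jb (x t)) *ᵥ u t) ⬝ᵥ (Q *ᵥ (hfun (x t) + (Jb (x t)) *ᵥ u t)) +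
          2 * ((hfun (x t) + (Jb (x t)) *ᵥ u t) ⬝ᵥ (S *ᵥ u t)) +
          (u t) ⬝ᵥ (R *ᵥ (u t))) := by
  intro t₀ t₁ ht u hu x hxΩ hx
  have hQ : IsUnit Q.det := by
    have h := (isUnit_iff_isUnit_det _).1 hQneg.isUnit
    rw [det_neg] at h
    exact isUnit_of_mul_isUnit_right h
  have hxc : ContinuousOn x (Set.Icc t₀ t₁) :=
    fun t h => (hx t h).continuousAt.continuousWithinAt
  have hy : ContinuousOn (fun t => hfun (x t) + Jb (x t) *ᵥ u t) (Set.Icc t₀ t₁) :=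
    (hh.comp_continuousOn hxc).add
      ((continuous_fst.matrix_mulVec continuous_snd).comp_continuousOn
        ((hJb.comp_continuousOn hxc).prodMk hu))
  have hrhs : ContinuousOn (fun t => f (x t) + Gb (x t) *ᵥ u t) (Set.Icc t₀ t₁) :=
    (hf.comp_continuousOn hxc).add
      ((continuous_fst.matrix_mulVec continuous_snd).comp_continuousOn
        ((hGb.comp_continuousOn hxc).prodMk hu))
  have hdot : ∀ {k : ℕ} {a b : ℝ → Fin k → ℝ}, ContinuousOn a (Set.Icc t₀ t₁) →
      ContinuousOn b (Set.Icc t₀ t₁) → ContinuousOn (fun t => a t ⬝ᵥ b t) (Set.Icc t₀ t₁) :=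
    fun ha hb => (continuous_fst.dotProduct continuous_snd).comp_continuousOn (ha.prodMk hb)
  have hmul : ∀ {k l : ℕ} (A : Matrix (Fin k) (Fin l) ℝ) {b : ℝ → Fin l → ℝ},
      ContinuousOn b (Set.Icc t₀ t₁) → ContinuousOn (fun t => A *ᵥ b t) (Set.Icc t₀ t₁) :=
    fun A _ hb => (continuous_const.matrix_mulVec continuous_id).comp_continuousOn hb
  have hV' : ∀ t ∈ Set.Icc t₀ t₁, HasDerivAt (fun s => V (x s))
      (gradV (x t) ⬝ᵥ (f (x t) + Gb (x t) *ᵥ u t)) t := fun t h => by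
    rw [← hDV]
    exact (hV (x t)).comp_hasDerivAt t (hx t h)
  have hdVint : IntervalIntegrable (fun t => gradV (x t) ⬝ᵥ (f (x t) + Gb (x t) *ᵥ u t))
      MeasureTheory.volume t₀ t₁ :=
    (hdot (hgradV.comp_continuousOn hxc) hrhs).intervalIntegrable_of_Icc ht
  have hwint := (((hdot hy (hmul Q hy)).add
    (continuousOn_const (c := (2 : ℝ)) |>.mul (hdot hy (hmul S hu)))).add
      (hdot hu (hmul R hu))).intervalIntegrable_of_Icc (μ := MeasureTheory.volume) ht
  have hFTC := intervalIntegral.integral_eq_sub_of_hasDerivAt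
    (fun t h => hV' t (by rwa [Set.uIcc_of_le ht] at h)) hdVint
  have hle := intervalIntegral.integral_mono_on ht hdVint hwint fun t h =>
    dotProduct_le_supply_of_posSemidef_neg_qsrM _ _ _ _ _ Q hQ S R (hLMI _ (hxΩ t h)) (u t)
  rw [hFTC, sub_le_iff_le_add'] at hle
  exact hle
end

section
/- Let n, m, p be positive integers, let Q ∈ ℝ^{p×p} be symmetric and negative definite, S ∈ ℝ^{p×m}, R ∈ ℝ^{m×m} symmetric. Fix x ∈ ℝⁿ, vectors g ∈ ℝⁿ (representing f(x)), v ∈ ℝⁿ (representing ∇V(x)), h₀ ∈ ℝᵖ (representing h(x)), and matrices G₀ ∈ ℝ^{n×m} (representing Ḡ(x)) and J₀ ∈ ℝ^{p×m} (representing J̄(x)). If the symmetric (1+m+p)×(1+m+p) block matrix M = [[vᵀg, ½G₀ᵀv − Sᵀh₀, h₀ᵀ], [∗, −R − SᵀJ₀ − J₀ᵀS, J₀ᵀ], [∗, ∗, Q⁻¹]] (written row-wise with symmetric completion) is negative semidefinite, then for every u ∈ ℝ^m, setting y = h₀ + J₀u, one has vᵀ(g + G₀u) ≤ yᵀQy +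 2yᵀSu + uᵀRu. -/
open Matrix

/-- The matrix `qsrM` applied to a vector with first block `1`, computed blockwise. -/
theorem qsrM_mulVec {n m p : ℕ}
    (v g : Fin n → ℝ) (h0 : Fin p → ℝ)
    (G0 : Matrix (Fin n) (Fin m) ℝ) (J0 : Matrix (Fin p) (Fin m) ℝ)
    (Q : Matrix (Fin p) (Fin p) ℝ) (S : Matrix (Fin p) (Fin m) ℝ)
    (R : Matrix (Fin m) (Fin m) ℝ) (u : Fin m → ℝ) (w : Fin p → ℝ) :
    qsrM v g h0 G0 J0 Q S R *ᵥ Sum.elim (fun _ => 1) (Sum.elim u w) =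
      Sum.elim (fun _ => v ⬝ᵥ g + (((1 / 2 : ℝ) • (G0ᵀ *ᵥ v) - Sᵀ *ᵥ h0) ⬝ᵥ u + h0 ⬝ᵥ w))
        (Sum.elim
          (((1 / 2 : ℝ) • (G0ᵀ *ᵥ v) - Sᵀ *ᵥ h0) +
            ((-R - Sᵀ * J0 - J0ᵀ * S) *ᵥ u + J0ᵀ *ᵥ w))
          (h0 + (J0 *ᵥ u + Q⁻¹ *ᵥ w))) := by
  ext (i | i | i) <;> simp [qsrM, mulVec, dotProduct, Fintype.sum_sum_type]

/-- The quadratic form of `qsrM` at a vector with first block `1`. -/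
theorem dotProduct_qsrM_mulVec {n m p : ℕ}
    (v g : Fin n → ℝ) (h0 : Fin p → ℝ)
    (G0 : Matrix (Fin n) (Fin m) ℝ) (J0 : Matrix (Fin p) (Fin m) ℝ)
    (Q : Matrix (Fin p) (Fin p) ℝ) (S : Matrix (Fin p) (Fin m) ℝ)
    (R : Matrix (Fin m) (Fin m) ℝ) (u : Fin m → ℝ) (w : Fin p → ℝ) :
    Sum.elim (fun _ => 1) (Sum.elim u w) ⬝ᵥ
        (qsrM v g h0 G0 J0 Q S R *ᵥ Sum.elim (fun _ => 1) (Sum.elim u w)) =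
      v ⬝ᵥ (g + G0 *ᵥ u) - 2 * ((h0 + J0 *ᵥ u) ⬝ᵥ (S *ᵥ u)) - u ⬝ᵥ (R *ᵥ u) +
        2 * (w ⬝ᵥ (h0 + J0 *ᵥ u)) + w ⬝ᵥ (Q⁻¹ *ᵥ w) := by
  have transpose_left {k l : ℕ} (A : Matrix (Fin k) (Fin l) ℝ) (a : Fin k → ℝ) (b : Fin l → ℝ) :
      b ⬝ᵥ (Aᵀ *ᵥ a) = a ⬝ᵥ (A *ᵥ b) := by
    rw [mulVec_transpose, dotProduct_comm, dotProduct_mulVec]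
  rw [qsrM_mulVec, sumElim_dotProduct_sumElim, sumElim_dotProduct_sumElim,
    dotProduct_comm _ u]
  simp only [dotProduct_add, dotProduct_sub, dotProduct_smul, sub_mulVec, neg_mulVec,
    dotProduct_neg, add_dotProduct, ← mulVec_mulVec, transpose_left, smul_eq_mul,
    dotProduct_comm (S *ᵥ u) (J0 *ᵥ u), dotProduct_comm h0 w]
  have one_dotProduct (c : ℝ) : (fun _ : Unit => (1 : ℝ)) ⬝ᵥ (fun _ => c) = c := by
    simp [dotProduct]
  rw [one_dotProduct]
  ring

/-- the pointwise Schur-complement step underlying Theorem 1: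
if the QSR LMI at a point is negative semidefinite, then for every input `u`,
with `y = h₀ + J₀u`, one has `vᵀ(g + G₀u) ≤ yᵀQy + 2yᵀSu + uᵀRu`. -/
theorem qsr_lmi_pointwise_dissipation {n m p : ℕ}
    (hn : 0 < n) (hm : 0 < m) (hp : 0 < p)
    (Q : Matrix (Fin p) (Fin p) ℝ) (hQsymm : Q.IsSymm) (hQneg : (-Q).PosDef)
    (S : Matrix (Fin p) (Fin m) ℝ)
    (R : Matrix (Fin m) (Fin m) ℝ) (hRsymm : R.IsSymm)
    (g v : Fin n → ℝ) (h0 : Fin p → ℝ)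
    (G0 : Matrix (Fin n) (Fin m) ℝ) (J0 : Matrix (Fin p) (Fin m) ℝ)
    (hM : (-(qsrM v g h0 G0 J0 Q S R)).PosSemidef) :
    ∀ u : Fin m → ℝ,
      v ⬝ᵥ (g + G0 *ᵥ u) ≤
        (h0 + J0 *ᵥ u) ⬝ᵥ (Q *ᵥ (h0 + J0 *ᵥ u)) +
          2 * ((h0 + J0 *ᵥ u) ⬝ᵥ (S *ᵥ u)) + u ⬝ᵥ (R *ᵥ u) := by
  intro u
  have hQ : IsUnit Q.det := by
    rw [← isUnit_iff_isUnit_det]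
    simpa using hQneg.isUnit.neg
  set y := h0 + J0 *ᵥ u with hy
  have hform := hM.dotProduct_mulVec_nonneg
    (Sum.elim (fun _ => 1) (Sum.elim u (-(Q *ᵥ y))))
  rw [star_trivial, neg_mulVec, dotProduct_neg, dotProduct_qsrM_mulVec, ← hy, mulVec_neg,
    mulVec_mulVec, nonsing_inv_mul Q hQ, one_mulVec, neg_dotProduct, neg_dotProduct_neg,
    dotProduct_comm (Q *ᵥ y) y] at hform
  linarith
end

section
/- Let n be a positive integer, let σ = co{x₀,…,xₙ} ⊂ ℝⁿ be an n-simplex, and let ζ : ℝⁿ → ℝⁿ be twice continuously differentiable on a neighborhood of σ. Let β ≥ 0 satisfy β ≥ |∂²ζ⁽ᵖ⁾(x)/∂x⁽q⁾∂x⁽r⁾ evaluated at ξ| for all p, q, r ∈ {1,…,n} and all ξ ∈ σ, and for j = 0,…,n define c̄ⱼ = ‖xⱼ − x₀‖₂ ( max_{k∈{1,…,n}} ‖x_k − x₀‖₂ + ‖xⱼ − x₀‖₂ ). Then for every x ∈ σ with barycentric coordinates λ₀,…,λₙ (λⱼ ≥ 0, Σⱼλⱼ = 1, x = Σⱼλⱼxⱼ),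 one has ‖ζ(x) − Σ_{j=0}^n λⱼ ζ(xⱼ)‖_∞ ≤ ½ n β Σ_{j=0}^n λⱼ c̄ⱼ. -/
open Matrix

/-- The Euclidean (2-)norm of a finitely indexed real vector. -/
noncomputable def norm2 {ι : Type*} [Fintype ι] (v : ι → ℝ) : ℝ :=
  Real.sqrt (∑ i, v i ^ 2)

lemma norm2_nonneg {ι : Type*} [Fintype ι] (v : ι → ℝ) : 0 ≤ norm2 v :=
  Real.sqrt_nonneg _

lemma norm2_sq {ι : Type*} [Fintype ι] (v : ι → ℝ) : norm2 v ^ 2 = ∑ i, v i ^ 2 :=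
  Real.sq_sqrt (Finset.sum_nonneg fun _ _ => sq_nonneg _)

lemma norm2_sq_sum_smul_le {ι κ : Type*} [Fintype ι] [Fintype κ] (w : κ → ℝ) (u : κ → ι → ℝ)
    (hw0 : ∀ j, 0 ≤ w j) (hw1 : ∑ j, w j = 1) :
    norm2 (∑ j, w j • u j) ^ 2 ≤ ∑ j, w j * norm2 (u j) ^ 2 := by
  simp only [norm2_sq, Finset.mul_sum]
  rw [Finset.sum_comm]
  refine Finset.sum_le_sum fun i _ => ?_
  have h := (even_two.convexOn_pow (𝕜 := ℝ)).map_sum_le (t := Finset.univ) (w := w)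
    (p := fun j => u j i) (fun j _ => hw0 j) hw1 (fun _ _ => Set.mem_univ _)
  simpa [Finset.sum_apply] using h

/-- Second-order Taylor estimate on `[0, 1]` for a real function whose second derivative is
bounded by `M`. -/
lemma abs_taylor_one_le {h h' h'' : ℝ → ℝ} {M : ℝ}
    (h1 : ∀ t ∈ Set.Icc (0 : ℝ) 1, HasDerivAt h (h' t) t)
    (h2 : ∀ t ∈ Set.Icc (0 : ℝ) 1, HasDerivAt h' (h'' t) t)
    (hM : ∀ t ∈ Set.Icc (0 : ℝ) 1, |h'' t| ≤ M) :
    |h 1 - h 0 - h' 0| ≤ M / 2 := by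
  have key : ∀ t ∈ Set.Icc (0 : ℝ) 1, ‖h' t - h' 0‖ ≤ M * t := by
    intro t ht
    have := norm_image_sub_le_of_norm_deriv_le_segment' (f := h') (f' := h'') (C := M)
      (a := 0) (b := 1) (fun s hs => (h2 s hs).hasDerivWithinAt)
      (fun s hs => hM s ⟨hs.1, hs.2.le⟩) t ht
    simpa using this
  have hk : ∀ t ∈ Set.Icc (0 : ℝ) 1,
      HasDerivAt (fun s => h s - h 0 - s * h' 0) (h' t - h' 0) t := by
    intro t ht
    have := ((h1 t ht).sub_const (h 0)).sub ((hasDerivAt_id t).mul_const (h' 0))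
    rw [one_mul] at this
    exact this
  have hB : ∀ t : ℝ, HasDerivAt (fun s : ℝ => M / 2 * s ^ 2) (M * t) t := by
    intro t
    have := (hasDerivAt_pow 2 t).const_mul (M / 2)
    exact this.congr_deriv (by norm_num; ring)
  have := image_norm_le_of_norm_deriv_right_le_deriv_boundary
    (f := fun s => h s - h 0 - s * h' 0) (f' := fun t => h' t - h' 0) (a := 0) (b := 1)
    (fun t ht => (hk t ht).continuousAt.continuousWithinAt)
    (fun t ht => (hk t ⟨ht.1, ht.2.le⟩).hasDerivWithinAt)
    (B := fun s => M / 2 * s ^ 2) (B' := fun t => M * t) (by simp) hB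
    (fun t ht => key t ⟨ht.1, ht.2.le⟩) (Set.right_mem_Icc.2 zero_le_one)
  simpa using this

/-- A bilinear form whose entries in the standard basis are at most `β` in absolute value is
bounded by `n β` times the Euclidean norm squared on the diagonal. -/
lemma abs_bilin_diag_le {n : ℕ} (B : (Fin n → ℝ) →L[ℝ] (Fin n → ℝ) →L[ℝ] ℝ) {β : ℝ}
    (hβ0 : 0 ≤ β) (hB : ∀ q r, |B (Pi.single r 1) (Pi.single q 1)| ≤ β) (v : Fin n → ℝ) :
    |B v v| ≤ n * β * norm2 v ^ 2 := by
  have hv : v = ∑ i, v i • (Pi.single i 1 : Fin n → ℝ) := pi_eq_sum_univ' v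
  have hexp : B v v = ∑ r, ∑ q, v r * v q * B (Pi.single r 1) (Pi.single q 1) := by
    conv_lhs => rw [hv]
    simp only [map_sum, map_smul, _root_.sum_apply, _root_.smul_apply,
      smul_eq_mul, Finset.mul_sum]
    rw [Finset.sum_comm]
    exact Finset.sum_congr rfl fun r _ => Finset.sum_congr rfl fun q _ => by ring
  calc |B v v| ≤ ∑ r, ∑ q, |v r| * |v q| * β := by
        rw [hexp]
        refine (Finset.abs_sum_le_sum_abs _ _).trans (Finset.sum_le_sum fun r _ => ?_)
        refine (Finset.abs_sum_le_sum_abs _ _).trans (Finset.sum_le_sum fun q _ => ?_)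
        rw [abs_mul, abs_mul]
        exact mul_le_mul_of_nonneg_left (hB q r) (by positivity)
    _ = β * (∑ i, |v i|) ^ 2 := by
        rw [sq, Finset.sum_mul_sum, Finset.mul_sum]
        refine Finset.sum_congr rfl fun r _ => ?_
        rw [Finset.mul_sum]
        exact Finset.sum_congr rfl fun q _ => by ring
    _ ≤ β * (n * ∑ i, v i ^ 2) := by
        refine mul_le_mul_of_nonneg_left ?_ hβ0
        simpa using sq_sum_le_card_mul_sum_sq (s := Finset.univ) (f := fun i => |v i|)
    _ = n * β * norm2 v ^ 2 := by rw [norm2_sq]; ring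

/-- Multivariate second-order Taylor estimate on a convex set, with second partial derivatives
bounded by `β`. -/
lemma abs_sub_sub_fderiv_le {n : ℕ} {g : (Fin n → ℝ) → ℝ} {S : Set (Fin n → ℝ)}
    (hS : Convex ℝ S) (hg : ∀ ξ ∈ S, ContDiffAt ℝ 2 g ξ) {β : ℝ} (hβ0 : 0 ≤ β)
    (hβ : ∀ q r : Fin n, ∀ ξ ∈ S,
      |fderiv ℝ (fun y => fderiv ℝ g y (Pi.single q 1)) ξ (Pi.single r 1)| ≤ β)
    {a y : Fin n → ℝ} (ha : a ∈ S) (hy : y ∈ S) :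
    |g y - g a - fderiv ℝ g a (y - a)| ≤ n * β * norm2 (y - a) ^ 2 / 2 := by
  set v := y - a with hv
  have hmem : ∀ t ∈ Set.Icc (0 : ℝ) 1, a + t • v ∈ S := fun t ht =>
    hS.add_smul_sub_mem ha hy ht
  have hdiff : ∀ ξ ∈ S, DifferentiableAt ℝ (fderiv ℝ g) ξ := fun ξ hξ =>
    ((hg ξ hξ).fderiv_right (m := 1) (by norm_num)).differentiableAt (by norm_num)
  have hline : ∀ t : ℝ, HasDerivAt (fun s : ℝ => a + s • v) v t := fun t => by
    simpa using ((hasDerivAt_id t).smul_const v).const_add a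
  have main := abs_taylor_one_le (h := fun t => g (a + t • v))
    (h' := fun t => fderiv ℝ g (a + t • v) v)
    (h'' := fun t => fderiv ℝ (fderiv ℝ g) (a + t • v) v v)
    (M := n * β * norm2 v ^ 2)
    (fun t ht => (((hg _ (hmem t ht)).differentiableAt
      (by norm_num)).hasFDerivAt.comp_hasDerivAt t (hline t)))
    (fun t ht => by
      have h := (hdiff _ (hmem t ht)).hasFDerivAt.comp_hasDerivAt t (hline t)
      exact ((ContinuousLinearMap.apply ℝ ℝ v).hasFDerivAt.comp_hasDerivAt t h))
    (fun t ht => by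
      refine abs_bilin_diag_le _ hβ0 (fun q r => ?_) v
      have h := hβ q r _ (hmem t ht)
      have hq := ((ContinuousLinearMap.apply ℝ ℝ (Pi.single q 1 : Fin n → ℝ)).hasFDerivAt.comp
        (a + t • v) (hdiff _ (hmem t ht)).hasFDerivAt).fderiv
      simp only [Function.comp_def, ContinuousLinearMap.apply_apply] at hq
      rw [hq] at h
      exact h)
  simpa [hv] using main

/-- Lemma 2 of the paper, the Giesl interpolation error bound: for a
`C²` function `ζ` on a neighborhood of the simplex `σ = co{x₀,…,xₙ}` with second
partial derivatives bounded by `β` on `σ`, and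
`c̄ⱼ = ‖xⱼ − x₀‖₂ (maxₖ ‖xₖ − x₀‖₂ + ‖xⱼ − x₀‖₂)`, for every `x ∈ σ` with
barycentric coordinates `λ₀,…,λₙ` one has
`‖ζ(x) − Σⱼ λⱼ ζ(xⱼ)‖_∞ ≤ ½ n β Σⱼ λⱼ c̄ⱼ`. -/
theorem giesl_interpolation_error_bound {n : ℕ} (hn : 0 < n)
    (pts : Fin (n + 1) → (Fin n → ℝ))
    (hind : LinearIndependent ℝ (fun j : Fin n => pts j.succ - pts 0))
    (ζ : (Fin n → ℝ) → (Fin n → ℝ))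
    (U : Set (Fin n → ℝ)) (hU : IsOpen U)
    (hσU : convexHull ℝ (Set.range pts) ⊆ U)
    (hζ : ContDiffOn ℝ 2 ζ U)
    (β : ℝ) (hβ0 : 0 ≤ β)
    (hβ : ∀ p q r : Fin n, ∀ ξ ∈ convexHull ℝ (Set.range pts),
      |fderiv ℝ (fun y => fderiv ℝ (fun z => ζ z p) y (Pi.single q 1)) ξ
        (Pi.single r 1)| ≤ β)
    (lam : Fin (n + 1) → ℝ)
    (hlam0 : ∀ j, 0 ≤ lam j) (hlam1 : ∑ j, lam j = 1)
    (x : Fin n → ℝ) (hx : x = ∑ j, lam j • pts j) :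
    ‖ζ x - ∑ j, lam j • ζ (pts j)‖ ≤
      (1 / 2) * n * β * ∑ j, lam j *
        (norm2 (pts j - pts 0) *
          ((Finset.univ.sup'
              (Finset.univ_nonempty_iff.mpr (Fin.pos_iff_nonempty.mp hn))
              fun k : Fin n => norm2 (pts k.succ - pts 0)) +
            norm2 (pts j - pts 0))) := by
  set S := convexHull ℝ (Set.range pts) with hSdef
  set m := Finset.univ.sup' (Finset.univ_nonempty_iff.mpr (Fin.pos_iff_nonempty.mp hn))
    fun k : Fin n => norm2 (pts k.succ - pts 0) with hm
  have hpts : ∀ j, pts j ∈ S := fun j => subset_convexHull ℝ _ ⟨j, rfl⟩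
  have hSconv : Convex ℝ S := convex_convexHull ℝ _
  have hxS : x ∈ S := hx ▸ hSconv.sum_mem (fun j _ => hlam0 j) hlam1 (fun j _ => hpts j)
  have hxsub : x - pts 0 = ∑ j, lam j • (pts j - pts 0) := by
    simp only [smul_sub, Finset.sum_sub_distrib, ← Finset.sum_smul, hlam1, one_smul, hx]
  have hsq : ∀ j, norm2 (pts j - pts 0) ^ 2 ≤ norm2 (pts j - pts 0) * m := by
    intro j
    refine Fin.cases ?_ (fun k => ?_) j
    · simp [norm2]
    · rw [sq]
      exact mul_le_mul_of_nonneg_left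
        (Finset.le_sup' (fun k : Fin n => norm2 (pts k.succ - pts 0)) (Finset.mem_univ k))
        (norm2_nonneg _)
  have hxsq : norm2 (x - pts 0) ^ 2 ≤ ∑ j, lam j * (norm2 (pts j - pts 0) * m) := by
    rw [hxsub]
    exact (norm2_sq_sum_smul_le lam _ hlam0 hlam1).trans
      (Finset.sum_le_sum fun j _ => mul_le_mul_of_nonneg_left (hsq j) (hlam0 j))
  have hsplit : ∑ j, lam j * (norm2 (pts j - pts 0) * (m + norm2 (pts j - pts 0))) =
      ∑ j, lam j * (norm2 (pts j - pts 0) * m) + ∑ j, lam j * norm2 (pts j - pts 0) ^ 2 := by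
    rw [← Finset.sum_add_distrib]
    exact Finset.sum_congr rfl fun j _ => by ring
  have hnβ : 0 ≤ (n : ℝ) * β := by positivity
  have hrhs : 0 ≤ ∑ j, lam j * (norm2 (pts j - pts 0) * m) :=
    (sq_nonneg _).trans hxsq
  have hrhs' : 0 ≤ ∑ j, lam j * norm2 (pts j - pts 0) ^ 2 :=
    Finset.sum_nonneg fun j _ => mul_nonneg (hlam0 j) (sq_nonneg _)
  rw [hsplit]
  refine (pi_norm_le_iff_of_nonneg (by positivity)).2 fun p => ?_
  set g : (Fin n → ℝ) → ℝ := fun z => ζ z p with hg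
  have hgd : ∀ ξ ∈ S, ContDiffAt ℝ 2 g ξ := fun ξ hξ =>
    contDiffAt_pi.1 (hζ.contDiffAt (hU.mem_nhds (hσU hξ))) p
  have taylor : ∀ y ∈ S, |g y - g (pts 0) - fderiv ℝ g (pts 0) (y - pts 0)| ≤
      n * β * norm2 (y - pts 0) ^ 2 / 2 := fun y hy =>
    abs_sub_sub_fderiv_le hSconv hgd hβ0 (hβ p) (hpts 0) hy
  set R : (Fin n → ℝ) → ℝ := fun y => g y - g (pts 0) - fderiv ℝ g (pts 0) (y - pts 0) with hR
  have hsum : ∑ j, lam j * R (pts j) =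
      ∑ j, lam j * g (pts j) - g (pts 0) - fderiv ℝ g (pts 0) (x - pts 0) := by
    rw [hxsub, map_sum]
    simp only [hR, mul_sub, Finset.sum_sub_distrib, ← Finset.sum_mul, hlam1, one_mul, map_smul,
      smul_eq_mul]
  have hcomp : (ζ x - ∑ j, lam j • ζ (pts j)) p = R x - ∑ j, lam j * R (pts j) := by
    rw [hsum]
    simp [hR, hg, Finset.sum_apply]
  have hbound : |∑ j, lam j * R (pts j)| ≤
      n * β / 2 * ∑ j, lam j * norm2 (pts j - pts 0) ^ 2 := by
    rw [Finset.mul_sum]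
    refine (Finset.abs_sum_le_sum_abs _ _).trans (Finset.sum_le_sum fun j _ => ?_)
    rw [abs_mul, abs_of_nonneg (hlam0 j)]
    calc lam j * |R (pts j)| ≤ lam j * (n * β * norm2 (pts j - pts 0) ^ 2 / 2) :=
          mul_le_mul_of_nonneg_left (taylor _ (hpts j)) (hlam0 j)
      _ = n * β / 2 * (lam j * norm2 (pts j - pts 0) ^ 2) := by ring
  rw [hcomp, Real.norm_eq_abs]
  have hx1 := taylor x hxS
  have hx2 := mul_le_mul_of_nonneg_left hxsq hnβ
  have habs := abs_sub (R x) (∑ j, lam j * R (pts j))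
  linarith
end

section
/- Let n, m be positive integers, let φ : ℝⁿ → ℝ and ζ : ℝⁿ → ℝ^m be twice continuously differentiable, let σ = co{x₀,…,xₙ} ⊂ ℝⁿ be an n-simplex, and define M(x) = [[φ(x), ζ(x)ᵀ], [ζ(x), −I_m]] ∈ ℝ^{(1+m)×(1+m)}. Let Π ∈ ℝ^{m×m} be diagonal and positive definite. Fix x ∈ σ with barycentric coordinates λ₀,…,λₙ, and suppose φ̂₀,…,φ̂ₙ ≥ 0 and ζ̂ = (ζ̂₁,…,ζ̂_m) with ζ̂_k ≥ 0 satisfy: for every j ∈ {0,…,n} and every z ∈ σ, |⟨H_φ(z)(xⱼ−x), xⱼ−x⟩| ≤ φ̂ⱼ, and for every k ∈ {1,…,m}, every j ∈ {0,…,n}, and every z ∈ σ, |⟨H_{ζ⁽ᵏ⁾}(z)(xⱼ−x), xⱼ−x⟩| ≤ ζ̂_k. Then M(x) − Σ_{j=0}^n λⱼ M(xⱼ) ⪯ Σ_{j=0}^n λⱼ · blockdiag( ½φ̂ⱼ + ½ ζ̂ᵀΠζ̂ , ½Π⁻¹ ), where the right-hand side is the (1+m)×(1+m) block-diagonal matrix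 with scalar block ½φ̂ⱼ + ½ζ̂ᵀΠζ̂ and m×m block ½Π⁻¹. -/
open Matrix

/-- The block matrix `M(x) = [[φ(x), ζ(x)ᵀ], [ζ(x), −I_m]]`. -/
noncomputable def Mblock {n m : ℕ}
    (φ : (Fin n → ℝ) → ℝ) (ζ : (Fin n → ℝ) → (Fin m → ℝ))
    (x : Fin n → ℝ) : Matrix (Unit ⊕ Fin m) (Unit ⊕ Fin m) ℝ :=
  Matrix.fromBlocks
    (Matrix.of fun _ _ : Unit => φ x)
    (Matrix.of fun (_ : Unit) k => ζ x k)
    (Matrix.of fun k (_ : Unit) => ζ x k)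
    (-1)

/-- Second-order Taylor estimate along a segment, from a bound on the second derivative in the
direction of the segment. -/
theorem norm_sub_sub_fderiv_le_of_norm_fderiv_fderiv_le {E F : Type*}
    [NormedAddCommGroup E] [NormedSpace ℝ E] [NormedAddCommGroup F] [NormedSpace ℝ F]
    {f : E → F} (hf : ContDiff ℝ 2 f) {x v : E} {C : ℝ}
    (hC : ∀ t ∈ Set.Icc (0 : ℝ) 1, ‖fderiv ℝ (fderiv ℝ f) (x + t • v) v v‖ ≤ C) :
    ‖f (x + v) - f x - fderiv ℝ f x v‖ ≤ C / 2 := by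
  have hline (t : ℝ) : HasDerivAt (fun t : ℝ => x + t • v) v t := by
    simpa using ((hasDerivAt_id t).smul_const v).const_add x
  have hd : Differentiable ℝ f := hf.differentiable (by norm_num)
  have hd' : Differentiable ℝ (fderiv ℝ f) :=
    (hf.fderiv_right (m := 1) (by norm_num)).differentiable (by norm_num)
  have h1 (t : ℝ) : HasDerivAt (fun t : ℝ => f (x + t • v) - f x - t • fderiv ℝ f x v)
      (fderiv ℝ f (x + t • v) v - fderiv ℝ f x v) t := by
    have h := ((hd (x + t • v)).hasFDerivAt.comp_hasDerivAt t (hline t)).sub_const (f x)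
    simpa using h.fun_sub ((hasDerivAt_id t).smul_const (fderiv ℝ f x v))
  have h2 (t : ℝ) : HasDerivAt (fun t : ℝ => fderiv ℝ f (x + t • v) v - fderiv ℝ f x v)
      (fderiv ℝ (fderiv ℝ f) (x + t • v) v v) t := by
    have h := (hd' (x + t • v)).hasFDerivAt.comp_hasDerivAt t (hline t)
    simpa using (h.clm_apply (hasDerivAt_const t v)).sub_const (fderiv ℝ f x v)
  have hb1 : ∀ t ∈ Set.Icc (0 : ℝ) 1, ‖fderiv ℝ f (x + t • v) v - fderiv ℝ f x v‖ ≤ C * t := by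
    intro t ht
    refine image_norm_le_of_norm_deriv_right_le_deriv_boundary (a := 0) (b := 1)
      (fun s _ => (h2 s).continuousAt.continuousWithinAt) (fun s _ => (h2 s).hasDerivWithinAt)
      (B := fun t => C * t) (B' := fun _ => C) (by simp)
      (fun s => by simpa using (hasDerivAt_id s).const_mul C)
      (fun s hs => hC s (Set.Ico_subset_Icc_self hs)) ht
  have hb2 := image_norm_le_of_norm_deriv_right_le_deriv_boundary (a := 0) (b := 1)
      (fun s _ => (h1 s).continuousAt.continuousWithinAt) (fun s _ => (h1 s).hasDerivWithinAt)
      (B := fun t => C / 2 * t ^ 2) (B' := fun t => C * t) (by simp)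
      (fun s => ((hasDerivAt_pow 2 s).const_mul (C / 2)).congr_deriv (by norm_num; ring))
      (fun s hs => hb1 s (Set.Ico_subset_Icc_self hs)) (Set.right_mem_Icc.2 zero_le_one)
  simpa using hb2

/-- Error bound for linear interpolation at a convex combination `x` of points `p j`. -/
theorem abs_sub_sum_le_of_abs_fderiv_fderiv_le {ι E : Type*} [Fintype ι]
    [NormedAddCommGroup E] [NormedSpace ℝ E] {f : E → ℝ} (hf : ContDiff ℝ 2 f)
    {p : ι → E} {w : ι → ℝ} {x : E} (hw0 : ∀ j, 0 ≤ w j) (hw1 : ∑ j, w j = 1)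
    (hx : x = ∑ j, w j • p j) {C : ι → ℝ}
    (hC : ∀ j, ∀ z ∈ convexHull ℝ (Set.range p),
      |fderiv ℝ (fderiv ℝ f) z (p j - x) (p j - x)| ≤ C j) :
    |f x - ∑ j, w j * f (p j)| ≤ 1 / 2 * ∑ j, w j * C j := by
  have hxmem : x ∈ convexHull ℝ (Set.range p) := by
    rw [hx]
    exact (convex_convexHull ℝ _).sum_mem (fun j _ => hw0 j) hw1
      (fun j _ => subset_convexHull ℝ _ (Set.mem_range_self j))
  have htaylor (j : ι) : |f (p j) - f x - fderiv ℝ f x (p j - x)| ≤ C j / 2 := by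
    have h := norm_sub_sub_fderiv_le_of_norm_fderiv_fderiv_le hf (x := x) (v := p j - x)
      (C := C j) (fun t ht => hC j _ ((convex_convexHull ℝ _).add_smul_sub_mem hxmem
        (subset_convexHull ℝ _ (Set.mem_range_self j)) ht))
    simpa using h
  have hlin : ∑ j, w j * fderiv ℝ f x (p j - x) = 0 := by
    have h : ∑ j, w j • (p j - x) = 0 := by
      simp only [smul_sub, Finset.sum_sub_distrib, ← Finset.sum_smul, hw1, one_smul, ← hx,
        sub_self]
    simpa using congrArg (fderiv ℝ f x) h
  have hsum : f x - ∑ j, w j * f (p j) =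
      -∑ j, w j * (f (p j) - f x - fderiv ℝ f x (p j - x)) := by
    simp only [mul_sub, Finset.sum_sub_distrib, ← Finset.sum_mul, hw1] at hlin ⊢
    linarith
  rw [hsum, abs_neg, Finset.mul_sum]
  refine (Finset.abs_sum_le_sum_abs _ _).trans (Finset.sum_le_sum fun j _ => ?_)
  rw [abs_mul, abs_of_nonneg (hw0 j)]
  nlinarith [mul_le_mul_of_nonneg_left (htaylor j) (hw0 j)]

/-- Young's inequality with weight `d`, for a cross term whose coefficient is at most `c / 2`. -/
theorem two_mul_mul_le_of_abs_le_half {a b c d e : ℝ} (hd : 0 < d) (he : |e| ≤ 1 / 2 * c) :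
    2 * a * e * b ≤ 1 / 2 * (c * (d * c)) * a ^ 2 + 1 / 2 * d⁻¹ * b ^ 2 := by
  have h1 : 2 * a * e * b ≤ c * |a| * |b| := by
    have h : 2 * a * e * b ≤ 2 * |a| * |e| * |b| := by
      simpa [abs_mul] using le_abs_self (2 * a * e * b)
    nlinarith [mul_le_mul_of_nonneg_left he (mul_nonneg (abs_nonneg a) (abs_nonneg b))]
  have h2 : 1 / 2 * (c * (d * c)) * a ^ 2 + 1 / 2 * d⁻¹ * b ^ 2 - c * |a| * |b| =
      1 / 2 * d⁻¹ * (d * c * |a| - |b|) ^ 2 := by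
    rw [← sq_abs a, ← sq_abs b]
    field_simp
    ring
  have h3 : 0 ≤ 1 / 2 * d⁻¹ * (d * c * |a| - |b|) ^ 2 := by positivity
  linarith

/-- A symmetric bordered diagonal matrix is positive semidefinite when its corner dominates the
border, weighted by the inverse of the diagonal. -/
theorem posSemidef_fromBlocks_diagonal_of_abs_le {m : Type*} [Fintype m] [DecidableEq m]
    {α : ℝ} {e c d : m → ℝ} (hd : ∀ k, 0 < d k) (he : ∀ k, |e k| ≤ 1 / 2 * c k)
    (hα : 1 / 2 * ∑ k, c k * (d k * c k) ≤ α) :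
    (Matrix.fromBlocks (Matrix.of fun _ _ : Unit => α) (Matrix.of fun (_ : Unit) k => -e k)
      (Matrix.of fun k (_ : Unit) => -e k)
      (Matrix.diagonal fun k => 1 / 2 * (d k)⁻¹)).PosSemidef := by
  refine Matrix.PosSemidef.of_dotProduct_mulVec_nonneg ?_ fun v => ?_
  · refine Matrix.IsHermitian.fromBlocks ?_ ?_ ?_
    · ext; simp
    · ext; simp
    · ext i j
      rcases eq_or_ne i j with rfl | h
      · simp
      · simp [Matrix.diagonal_apply_ne, h, h.symm]
  · set a := v (Sum.inl ())
    have hform : star v ⬝ᵥ (Matrix.fromBlocks (Matrix.of fun _ _ : Unit => α)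
        (Matrix.of fun (_ : Unit) k => -e k) (Matrix.of fun k (_ : Unit) => -e k)
        (Matrix.diagonal fun k => 1 / 2 * (d k)⁻¹)) *ᵥ v =
        α * a ^ 2 + ∑ k, (1 / 2 * (d k)⁻¹ * v (Sum.inr k) ^ 2 - 2 * a * e k * v (Sum.inr k)) := by
      simp only [dotProduct, Matrix.mulVec, Fintype.sum_sum_type, Matrix.fromBlocks_apply₁₁,
        Matrix.fromBlocks_apply₁₂, Matrix.fromBlocks_apply₂₁, Matrix.fromBlocks_apply₂₂,
        Matrix.diagonal_apply, Matrix.of_apply, Finset.univ_unique, Finset.sum_singleton,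
        ite_mul, zero_mul, Finset.sum_ite_eq, Finset.mem_univ, if_true, star_trivial]
      rw [mul_add, Finset.mul_sum, add_assoc, ← Finset.sum_add_distrib]
      rw [show v (Sum.inl default) = a from rfl]
      congr 1
      · ring
      · exact Finset.sum_congr rfl fun k _ => by ring
    rw [hform]
    have hyoung := Finset.sum_le_sum fun k (_ : k ∈ Finset.univ) =>
      two_mul_mul_le_of_abs_le_half (a := a) (b := v (Sum.inr k)) (hd k) (he k)
    have hcorner := mul_le_mul_of_nonneg_right hα (sq_nonneg a)
    rw [Finset.sum_add_distrib, ← Finset.sum_mul, ← Finset.mul_sum] at hyoung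
    rw [Finset.sum_sub_distrib]
    linarith

/-- the error-bound inequality of Theorem 3 of the paper: for
`M(x) = [[φ(x), ζ(x)ᵀ], [ζ(x), −I_m]]`, a diagonal positive definite `Π`, and
Hessian-remainder bounds `φ̂ⱼ`, `ζ̂ₖ` on the simplex, one has
`M(x) − Σⱼ λⱼ M(xⱼ) ⪯ Σⱼ λⱼ · blockdiag(½φ̂ⱼ + ½ζ̂ᵀΠζ̂, ½Π⁻¹)`. -/
theorem lmi_error_bound {n m : ℕ} (hn : 0 < n) (hm : 0 < m)
    (φ : (Fin n → ℝ) → ℝ) (hφ : ContDiff ℝ 2 φ)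
    (ζ : (Fin n → ℝ) → (Fin m → ℝ)) (hζ : ContDiff ℝ 2 ζ)
    (pts : Fin (n + 1) → (Fin n → ℝ))
    (hind : LinearIndependent ℝ (fun j : Fin n => pts j.succ - pts 0))
    (Pim : Matrix (Fin m) (Fin m) ℝ) (hPimDiag : Pim.IsDiag) (hPimPos : Pim.PosDef)
    (x : Fin n → ℝ) (lam : Fin (n + 1) → ℝ)
    (hlam0 : ∀ j, 0 ≤ lam j) (hlam1 : ∑ j, lam j = 1)
    (hx : x = ∑ j, lam j • pts j)
    (φhat : Fin (n + 1) → ℝ) (hφhat0 : ∀ j, 0 ≤ φhat j)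
    (ζhat : Fin m → ℝ) (hζhat0 : ∀ k, 0 ≤ ζhat k)
    (hφhat : ∀ j : Fin (n + 1), ∀ z ∈ convexHull ℝ (Set.range pts),
      |fderiv ℝ (fderiv ℝ φ) z (pts j - x) (pts j - x)| ≤ φhat j)
    (hζhat : ∀ (k : Fin m) (j : Fin (n + 1)), ∀ z ∈ convexHull ℝ (Set.range pts),
      |fderiv ℝ (fderiv ℝ (fun y => ζ y k)) z (pts j - x) (pts j - x)| ≤ ζhat k) :
    ((∑ j, lam j •
        Matrix.fromBlocks
          (Matrix.of fun _ _ : Unit =>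
            (1 / 2) * φhat j + (1 / 2) * (ζhat ⬝ᵥ (Pim *ᵥ ζhat)))
          0 0 ((1 / 2 : ℝ) • Pim⁻¹)) -
      (Mblock φ ζ x - ∑ j, lam j • Mblock φ ζ (pts j))).PosSemidef := by
  obtain ⟨d, rfl⟩ : ∃ d, Pim = Matrix.diagonal d := ⟨_, hPimDiag.diagonal_diag.symm⟩
  have hd : ∀ k, 0 < d k := Matrix.posDef_diagonal_iff.1 hPimPos
  have hφerr := abs_sub_sum_le_of_abs_fderiv_fderiv_le hφ hlam0 hlam1 hx hφhat
  have hζerr (k : Fin m) : |ζ x k - ∑ j, lam j * ζ (pts j) k| ≤ 1 / 2 * ζhat k := by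
    have h := abs_sub_sum_le_of_abs_fderiv_fderiv_le (contDiff_pi.1 hζ k) hlam0 hlam1 hx (hζhat k)
    rwa [← Finset.sum_mul, hlam1, one_mul] at h
  have hinv : (Matrix.diagonal d)⁻¹ = Matrix.diagonal fun k => (d k)⁻¹ := by
    refine Matrix.inv_eq_left_inv ?_
    rw [Matrix.diagonal_mul_diagonal, ← Matrix.diagonal_one]
    exact congrArg _ (funext fun k => inv_mul_cancel₀ (hd k).ne')
  have hquad : ζhat ⬝ᵥ (Matrix.diagonal d *ᵥ ζhat) = ∑ k, ζhat k * (d k * ζhat k) := by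
    simp [dotProduct, Matrix.mulVec_diagonal]
  convert posSemidef_fromBlocks_diagonal_of_abs_le hd hζerr
    (α := 1 / 2 * ∑ j, lam j * φhat j + 1 / 2 * ∑ k, ζhat k * (d k * ζhat k) -
      (φ x - ∑ j, lam j * φ (pts j))) (by linarith [le_of_abs_le hφerr]) using 1
  rw [hinv, hquad]
  ext (i | i) (j | j)
  · generalize ∑ k, ζhat k * (d k * ζhat k) = S
    simp [Mblock, Matrix.sum_apply, mul_add, Finset.sum_add_distrib, ← Finset.sum_mul, hlam1,
      Finset.mul_sum, mul_left_comm]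
  · simp [Mblock, Matrix.sum_apply]
  · simp [Mblock, Matrix.sum_apply]
  · simp [Mblock, Matrix.sum_apply, ← Finset.sum_mul, hlam1, Matrix.diagonal_apply]
end

section
/- Let n, m be positive integers, let φ : ℝⁿ → ℝ and ζ : ℝⁿ → ℝ^m be twice continuously differentiable, let σ = co{x₀,…,xₙ} ⊂ ℝⁿ be an n-simplex, and define M(x) = [[φ(x), ζ(x)ᵀ], [ζ(x), −I_m]] ∈ ℝ^{(1+m)×(1+m)}. Let Π ∈ ℝ^{m×m} be diagonal and positive definite. Suppose φ̂₀,…,φ̂ₙ ≥ 0 and ζ̂ = (ζ̂₁,…,ζ̂_m) with ζ̂_k ≥ 0 satisfy: for every j ∈ {0,…,n}, every x ∈ σ, and every z ∈ σ, |⟨H_φ(z)(xⱼ−x), xⱼ−x⟩| ≤ φ̂ⱼ, and for every k ∈ {1,…,m}, every j ∈ {0,…,n}, every x ∈ σ, and every z ∈ σ, |⟨H_{ζ⁽ᵏ⁾}(z)(xⱼ−x), xⱼ−x⟩| ≤ ζ̂_k. If for every vertex j ∈ {0,…,n} the matrix [[φ(xⱼ) + ½φ̂ⱼ + ½ζ̂ᵀΠζ̂,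 ζ(xⱼ)ᵀ], [ζ(xⱼ), −I_m + ½Π⁻¹]] is negative semidefinite, then M(x) is negative semidefinite for every x ∈ σ. -/
open Matrix

/-- A point of the convex hull of a finite family is a convex combination of the whole family. -/
theorem exists_stdSimplex_of_mem_convexHull_range {ι E : Type*} [Fintype ι]
    [AddCommGroup E] [Module ℝ E] {p : ι → E} {x : E} (hx : x ∈ convexHull ℝ (Set.range p)) :
    ∃ w ∈ stdSimplex ℝ ι, ∑ i, w i • p i = x := by
  classical
  have h : Set.range p =
      Fintype.linearCombination ℝ p '' Set.range fun i : ι => (Pi.single i (1 : ℝ) : ι → ℝ) := by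
    rw [← Set.range_comp]
    congr 1
    ext i
    simp [Fintype.linearCombination_apply_single]
  rw [h, ← LinearMap.image_convexHull, convexHull_rangle_single_eq_stdSimplex] at hx
  obtain ⟨w, hw, rfl⟩ := hx
  exact ⟨w, hw, by simp [Fintype.linearCombination_apply]⟩

/-- First-order Taylor estimate along a segment, from a bound on the second derivative in the
direction of that segment. -/
theorem abs_sub_sub_fderiv_le_of_abs_fderiv_fderiv_le {E : Type*} [NormedAddCommGroup E]
    [NormedSpace ℝ E] {f : E → ℝ} (hf : ContDiff ℝ 2 f) {x y : E} {C : ℝ}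
    (hC : ∀ z ∈ segment ℝ x y, |fderiv ℝ (fderiv ℝ f) z (y - x) (y - x)| ≤ C) :
    |f y - f x - fderiv ℝ f x (y - x)| ≤ C / 2 := by
  set v := y - x
  have hline : ∀ t : ℝ, HasDerivAt (fun s : ℝ => x + s • v) v t := fun t => by
    simpa using ((hasDerivAt_id t).smul_const v).const_add x
  have hf1 : Differentiable ℝ f := hf.differentiable (by norm_num)
  have hf2 : Differentiable ℝ (fderiv ℝ f) :=
    (hf.fderiv_right (m := 1) (by norm_num)).differentiable (by norm_num)
  have hd1 : ∀ t : ℝ, HasDerivAt (fun s : ℝ => f (x + s • v)) (fderiv ℝ f (x + t • v) v) t :=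
    fun t => (hf1 _).hasFDerivAt.comp_hasDerivAt t (hline t)
  have hd2 : ∀ t : ℝ, HasDerivAt (fun s : ℝ => fderiv ℝ f (x + s • v) v)
      (fderiv ℝ (fderiv ℝ f) (x + t • v) v v) t := fun t => by
    simpa using ((hf2 _).hasFDerivAt.comp_hasDerivAt t (hline t)).clm_apply (hasDerivAt_const t v)
  have hseg : ∀ t ∈ Set.Icc (0 : ℝ) 1, x + t • v ∈ segment ℝ x y := fun t ht => by
    rw [segment_eq_image']
    exact ⟨t, ht, rfl⟩
  have hslope : ∀ t ∈ Set.Icc (0 : ℝ) 1, ‖fderiv ℝ f (x + t • v) v - fderiv ℝ f x v‖ ≤ C * t := by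
    intro t ht
    have := norm_image_sub_le_of_norm_deriv_right_le_segment
      (fun s _ => (hd2 s).continuousAt.continuousWithinAt)
      (fun s _ => (hd2 s).hasDerivWithinAt)
      (fun s hs => hC _ (hseg s (Set.Ico_subset_Icc_self hs))) t ht
    simpa using this
  have hrem : ∀ t : ℝ, HasDerivAt (fun s : ℝ => f (x + s • v) - f x - s * fderiv ℝ f x v)
      (fderiv ℝ f (x + t • v) v - fderiv ℝ f x v) t := fun t => by
    have := ((hd1 t).sub_const (f x)).sub ((hasDerivAt_id t).mul_const (fderiv ℝ f x v))
    rwa [one_mul] at this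
  have hbound : ∀ t : ℝ, HasDerivAt (fun s : ℝ => C / 2 * s ^ 2) (C * t) t := fun t => by
    convert! (hasDerivAt_pow 2 t).const_mul (C / 2) using 1
    push_cast
    ring
  have := image_norm_le_of_norm_deriv_right_le_deriv_boundary
    (fun s _ => (hrem s).continuousAt.continuousWithinAt)
    (fun s _ => (hrem s).hasDerivWithinAt) (by simp) hbound
    (fun s hs => hslope s (Set.Ico_subset_Icc_self hs)) (Set.right_mem_Icc.2 zero_le_one)
  simpa [v] using this

/-- Error of linear interpolation at a convex combination, in terms of bounds on the second
derivative in the directions of the nodes. -/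
theorem abs_sum_mul_sub_le_of_abs_fderiv_fderiv_le {ι E : Type*} [Fintype ι]
    [NormedAddCommGroup E] [NormedSpace ℝ E] {f : E → ℝ} (hf : ContDiff ℝ 2 f)
    {p : ι → E} {w : ι → ℝ} (hw : w ∈ stdSimplex ℝ ι) {x : E} (hx : ∑ i, w i • p i = x)
    {C : ι → ℝ}
    (hC : ∀ i, ∀ z ∈ segment ℝ x (p i), |fderiv ℝ (fderiv ℝ f) z (p i - x) (p i - x)| ≤ C i) :
    |∑ i, w i * f (p i) - f x| ≤ ∑ i, w i * (C i / 2) := by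
  have hlin : ∑ i, w i * fderiv ℝ f x (p i - x) = 0 := by
    have : ∑ i, w i • (p i - x) = 0 := by
      simp only [smul_sub, Finset.sum_sub_distrib, hx, ← Finset.sum_smul, hw.2, one_smul, sub_self]
    simpa using congrArg (fderiv ℝ f x) this
  have hsum : ∑ i, w i * f (p i) - f x = ∑ i, w i * (f (p i) - f x - fderiv ℝ f x (p i - x)) := by
    simp only [mul_sub (w _), Finset.sum_sub_distrib, hlin, ← Finset.sum_mul, hw.2, one_mul,
      sub_zero]
  rw [hsum]
  refine (Finset.abs_sum_le_sum_abs _ _).trans (Finset.sum_le_sum fun i _ => ?_)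
  rw [abs_mul, abs_of_nonneg (hw.1 i)]
  exact mul_le_mul_of_nonneg_left
    (abs_sub_sub_fderiv_le_of_abs_fderiv_fderiv_le hf (hC i)) (hw.1 i)

/-- Weighted Young inequality for a perturbation `d` of size at most `e / 2`. -/
theorem two_mul_mul_mul_le_of_abs_le_half {s d v e c : ℝ} (hc : 0 < c) (hd : |d| ≤ e / 2) :
    2 * s * (d * v) ≤ s ^ 2 * (1 / 2 * (e * (c * e))) + 1 / 2 * (v * (c⁻¹ * v)) := by
  have h1 : 2 * s * (d * v) ≤ |s| * e * |v| := by
    calc 2 * s * (d * v) ≤ |2 * s * (d * v)| := le_abs_self _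
      _ = 2 * |s| * |v| * |d| := by simp only [abs_mul, abs_two]; ring
      _ ≤ 2 * |s| * |v| * (e / 2) := by gcongr
      _ = |s| * e * |v| := by ring
  have h2 : 0 ≤ c⁻¹ * (c * (|s| * e) - |v|) ^ 2 := by positivity
  have h3 : c⁻¹ * (c * (|s| * e) - |v|) ^ 2
      = s ^ 2 * (e * (c * e)) - 2 * (|s| * e * |v|) + v * (c⁻¹ * v) := by
    rw [← sq_abs s, show v * (c⁻¹ * v) = c⁻¹ * |v| ^ 2 by rw [sq_abs]; ring]
    field_simp
    ring
  linarith

/-- The quadratic form of a bordered matrix. -/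
theorem dotProduct_neg_fromBlocks_mulVec {κ : Type*} [Fintype κ] (a : ℝ) (b : κ → ℝ)
    (D : Matrix κ κ ℝ) (u : Unit ⊕ κ → ℝ) :
    u ⬝ᵥ (-(Matrix.fromBlocks (Matrix.of fun _ _ : Unit => a) (Matrix.of fun (_ : Unit) k => b k)
      (Matrix.of fun k (_ : Unit) => b k) D)) *ᵥ u =
    -(u (Sum.inl ()) ^ 2 * a + 2 * u (Sum.inl ()) * (b ⬝ᵥ (u ∘ Sum.inr))
      + (u ∘ Sum.inr) ⬝ᵥ (D *ᵥ (u ∘ Sum.inr))) := by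
  rw [Matrix.neg_mulVec, dotProduct_neg, Matrix.fromBlocks_mulVec]
  simp only [dotProduct, Fintype.sum_sum_type, Sum.elim_inl, Sum.elim_inr, Pi.add_apply, mulVec,
    of_apply, Finset.univ_unique, Finset.sum_singleton, Function.comp_apply, mul_add,
    Finset.sum_add_distrib, PUnit.default_eq_unit, Finset.mul_sum]
  have : ∑ k, 2 * u (Sum.inl ()) * (b k * u (Sum.inr k)) =
      ∑ k, u (Sum.inl ()) * (b k * u (Sum.inr k)) + ∑ k, u (Sum.inr k) * (b k * u (Sum.inl ())) := by
    rw [← Finset.sum_add_distrib]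
    exact Finset.sum_congr rfl fun k _ => by ring
  rw [this]
  ring

/-- the vertex-to-simplex propagation part of Theorem 3 of the paper:
if for every vertex `xⱼ` of the simplex the matrix
`[[φ(xⱼ) + ½φ̂ⱼ + ½ζ̂ᵀΠζ̂, ζ(xⱼ)ᵀ], [ζ(xⱼ), −I_m + ½Π⁻¹]]` is negative
semidefinite, then `M(x) = [[φ(x), ζ(x)ᵀ], [ζ(x), −I_m]]` is negative semidefinite
for every `x` in the simplex. -/
theorem lmi_vertex_to_simplex {n m : ℕ} (hn : 0 < n) (hm : 0 < m)
    (φ : (Fin n → ℝ) → ℝ) (hφ : ContDiff ℝ 2 φ)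
    (ζ : (Fin n → ℝ) → (Fin m → ℝ)) (hζ : ContDiff ℝ 2 ζ)
    (pts : Fin (n + 1) → (Fin n → ℝ))
    (hind : LinearIndependent ℝ (fun j : Fin n => pts j.succ - pts 0))
    (Pim : Matrix (Fin m) (Fin m) ℝ) (hPimDiag : Pim.IsDiag) (hPimPos : Pim.PosDef)
    (φhat : Fin (n + 1) → ℝ) (hφhat0 : ∀ j, 0 ≤ φhat j)
    (ζhat : Fin m → ℝ) (hζhat0 : ∀ k, 0 ≤ ζhat k)
    (hφhat : ∀ j : Fin (n + 1), ∀ x ∈ convexHull ℝ (Set.range pts),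
      ∀ z ∈ convexHull ℝ (Set.range pts),
      |fderiv ℝ (fderiv ℝ φ) z (pts j - x) (pts j - x)| ≤ φhat j)
    (hζhat : ∀ (k : Fin m) (j : Fin (n + 1)), ∀ x ∈ convexHull ℝ (Set.range pts),
      ∀ z ∈ convexHull ℝ (Set.range pts),
      |fderiv ℝ (fderiv ℝ (fun y => ζ y k)) z (pts j - x) (pts j - x)| ≤ ζhat k)
    (hvertex : ∀ j : Fin (n + 1),
      (-(Matrix.fromBlocks
          (Matrix.of fun _ _ : Unit =>
            φ (pts j) + (1 / 2) * φhat j + (1 / 2) * (ζhat ⬝ᵥ (Pim *ᵥ ζhat)))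
          (Matrix.of fun (_ : Unit) k => ζ (pts j) k)
          (Matrix.of fun k (_ : Unit) => ζ (pts j) k)
          ((-1 : Matrix (Fin m) (Fin m) ℝ) + (1 / 2 : ℝ) • Pim⁻¹))).PosSemidef) :
    ∀ x ∈ convexHull ℝ (Set.range pts), (-(Mblock φ ζ x)).PosSemidef := by
  intro x hx
  obtain ⟨w, hw, hwx⟩ := exists_stdSimplex_of_mem_convexHull_range hx
  have hseg : ∀ j, segment ℝ x (pts j) ⊆ convexHull ℝ (Set.range pts) := fun j =>
    (convex_convexHull ℝ _).segment_subset hx (subset_convexHull ℝ _ ⟨j, rfl⟩)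
  have hφerr : |∑ j, w j * φ (pts j) - φ x| ≤ ∑ j, w j * (φhat j / 2) :=
    abs_sum_mul_sub_le_of_abs_fderiv_fderiv_le hφ hw hwx
      fun j z hz => hφhat j x hx z (hseg j hz)
  have hζerr : ∀ k, |∑ j, w j * ζ (pts j) k - ζ x k| ≤ ζhat k / 2 := fun k => by
    have := abs_sum_mul_sub_le_of_abs_fderiv_fderiv_le (contDiff_pi.1 hζ k) hw hwx
      fun j z hz => hζhat k j x hx z (hseg j hz)
    rwa [← Finset.sum_mul, hw.2, one_mul] at this
  obtain ⟨c, rfl⟩ : ∃ c, Pim = Matrix.diagonal c := ⟨_, hPimDiag.diagonal_diag.symm⟩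
  have hc : ∀ k, 0 < c k := Matrix.posDef_diagonal_iff.1 hPimPos
  have hinv : (Matrix.diagonal c)⁻¹ = Matrix.diagonal fun k => (c k)⁻¹ :=
    Matrix.inv_eq_right_inv (by simp [Matrix.diagonal_mul_diagonal, (hc _).ne'])
  refine .of_dotProduct_mulVec_nonneg
    (Matrix.IsHermitian.fromBlocks (by ext; simp) (by ext; simp) (by simp [IsHermitian])).neg
    fun u => ?_
  rw [star_trivial, Mblock, dotProduct_neg_fromBlocks_mulVec]
  set s := u (Sum.inl ())
  set v := u ∘ Sum.inr
  set q := ζhat ⬝ᵥ (Matrix.diagonal c *ᵥ ζhat)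
  have hvert : ∀ j, s ^ 2 * (φ (pts j) + 1 / 2 * φhat j + 1 / 2 * q)
      + 2 * s * (ζ (pts j) ⬝ᵥ v) - v ⬝ᵥ v
      + 1 / 2 * (v ⬝ᵥ ((Matrix.diagonal fun k => (c k)⁻¹) *ᵥ v)) ≤ 0 := fun j => by
    have := (hvertex j).dotProduct_mulVec_nonneg u
    rw [star_trivial, dotProduct_neg_fromBlocks_mulVec, hinv, Matrix.add_mulVec,
      Matrix.neg_mulVec, Matrix.one_mulVec, Matrix.smul_mulVec, dotProduct_add, dotProduct_neg,
      dotProduct_smul, smul_eq_mul] at this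
    linarith
  have havg := Finset.sum_nonpos fun j (_ : j ∈ Finset.univ) =>
    mul_nonpos_of_nonneg_of_nonpos (hw.1 j) (hvert j)
  have hζavg : ∑ j, w j * (ζ (pts j) ⬝ᵥ v) = ∑ k, (∑ j, w j * ζ (pts j) k) * v k := by
    simp only [dotProduct, Finset.mul_sum, Finset.sum_mul, ← mul_assoc]
    exact Finset.sum_comm
  have hsplit : ∑ j, w j * (s ^ 2 * (φ (pts j) + 1 / 2 * φhat j + 1 / 2 * q)
      + 2 * s * (ζ (pts j) ⬝ᵥ v) - v ⬝ᵥ v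
      + 1 / 2 * (v ⬝ᵥ ((Matrix.diagonal fun k => (c k)⁻¹) *ᵥ v))) =
      s ^ 2 * (∑ j, w j * φ (pts j) + ∑ j, w j * (φhat j / 2) + 1 / 2 * q)
      + 2 * s * ∑ j, w j * (ζ (pts j) ⬝ᵥ v) - v ⬝ᵥ v
      + 1 / 2 * (v ⬝ᵥ ((Matrix.diagonal fun k => (c k)⁻¹) *ᵥ v)) := by
    simp only [mul_add (w _), mul_sub (w _), mul_left_comm (w _), Finset.sum_add_distrib,
      Finset.sum_sub_distrib, ← Finset.mul_sum, ← Finset.sum_mul, hw.2]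
    simp only [div_eq_mul_inv, ← mul_assoc, ← Finset.sum_mul]
    ring
  have hyoung := Finset.sum_le_sum fun k (_ : k ∈ Finset.univ) =>
    two_mul_mul_mul_le_of_abs_le_half (s := s) (v := v k) (hc k)
      ((abs_sub_comm _ _).trans_le (hζerr k))
  have hφle : s ^ 2 * φ x ≤ s ^ 2 * (∑ j, w j * φ (pts j) + ∑ j, w j * (φhat j / 2)) :=
    mul_le_mul_of_nonneg_left (by linarith [(abs_le.1 hφerr).1]) (sq_nonneg s)
  simp only [sub_mul, mul_sub, Finset.sum_sub_distrib, Finset.sum_add_distrib,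
    ← Finset.mul_sum] at hyoung
  have hq : q = ∑ k, ζhat k * (c k * ζhat k) := by
    simp [q, dotProduct, Matrix.mulVec_diagonal]
  have hv : v ⬝ᵥ ((Matrix.diagonal fun k => (c k)⁻¹) *ᵥ v) = ∑ k, v k * ((c k)⁻¹ * v k) := by
    simp [dotProduct, Matrix.mulVec_diagonal]
  have hζx : ζ x ⬝ᵥ v = ∑ k, ζ x k * v k := rfl
  rw [hsplit, hζavg] at havg
  rw [← hq, ← hv, ← hζx] at hyoung
  rw [Matrix.neg_mulVec, Matrix.one_mulVec, dotProduct_neg]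
  linarith
end

section
/- Let n, m be positive integers, let φ : ℝⁿ → ℝ and ζ : ℝⁿ → ℝ^m be twice continuously differentiable, let σ = co{x₀,…,xₙ} ⊂ ℝⁿ be an n-simplex, and define M(x) = [[φ(x), ζ(x)ᵀ], [ζ(x), −I_m]] ∈ ℝ^{(1+m)×(1+m)}. Let Π ∈ ℝ^{m×m} be diagonal and positive definite. Suppose φ̃₀,…,φ̃ₙ ≥ 0 and ζ̃ = (ζ̃₁,…,ζ̃_m) with ζ̃_k ≥ 0 satisfy: for every j ∈ {0,…,n}, every x ∈ σ, and all z, z′ ∈ σ, |⟨H_φ(z)(x−x₀), x−x₀⟩ − ⟨H_φ(z′)(xⱼ−x₀), xⱼ−x₀⟩| ≤ φ̃ⱼ, and for every k ∈ {1,…,m}, every j ∈ {0,…,n}, every x ∈ σ, and all z, z′ ∈ σ, |⟨H_{ζ⁽ᵏ⁾}(z)(x−x₀), x−x₀⟩ − ⟨H_{ζ⁽ᵏ⁾}(z′)(xⱼ−x₀), xⱼ−x₀⟩| ≤ ζ̃_k. Then: (i) for every x ∈ σ with barycentric coordinates λ₀,…,λₙ, M(x) − Σ_{j=0}^n λⱼ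 M(xⱼ) ⪯ Σ_{j=0}^n λⱼ · blockdiag( ½φ̃ⱼ + ½ζ̃ᵀΠζ̃ , ½Π⁻¹ ); and (ii) if for every vertex j the matrix [[φ(xⱼ) + ½φ̃ⱼ + ½ζ̃ᵀΠζ̃, ζ(xⱼ)ᵀ], [ζ(xⱼ), −I_m + ½Π⁻¹]] is negative semidefinite, then M(x) is negative semidefinite for every x ∈ σ. -/
open Matrix

/-- Second-order Taylor formula with Lagrange remainder along a segment. -/
theorem exists_segment_taylor_two {E : Type*} [NormedAddCommGroup E] [NormedSpace ℝ E]
    {g : E → ℝ} (hg : ContDiff ℝ 2 g) (a y : E) :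
    ∃ z ∈ segment ℝ a y,
      g y = g a + fderiv ℝ g a (y - a) + (1 / 2) * fderiv ℝ (fderiv ℝ g) z (y - a) (y - a) := by
  set v := y - a with hv
  have hg' : ContDiff ℝ 1 (fderiv ℝ g) := hg.fderiv_right (by norm_num)
  have hline (t : ℝ) : HasDerivAt (fun t : ℝ => a + t • v) v t := by
    simpa using ((hasDerivAt_id t).smul_const v).const_add a
  have hfst (t : ℝ) :
      HasDerivAt (fun t : ℝ => g (a + t • v)) (fderiv ℝ g (a + t • v) v) t :=
    ((hg.differentiable (by norm_num)) _).hasFDerivAt.comp_hasDerivAt t (hline t)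
  have hsnd (t : ℝ) : HasDerivAt (fun t : ℝ => fderiv ℝ g (a + t • v) v)
      (fderiv ℝ (fderiv ℝ g) (a + t • v) v v) t := by
    simpa using (((hg'.differentiable (by norm_num)) _).hasFDerivAt.comp_hasDerivAt t
      (hline t)).clm_apply (hasDerivAt_const t v)
  have hF (t : ℝ) : HasDerivAt
      (fun t : ℝ => g (a + t • v) + (1 - t) * fderiv ℝ g (a + t • v) v)
      ((1 - t) * fderiv ℝ (fderiv ℝ g) (a + t • v) v v) t := by
    exact ((hfst t).add (((hasDerivAt_id t).const_sub 1).mul (hsnd t))).congr_deriv (by simp)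
  have hG (t : ℝ) : HasDerivAt (fun t : ℝ => -(1 / 2) * (1 - t) ^ 2) (1 - t) t := by
    exact ((((hasDerivAt_id t).const_sub 1).pow 2).const_mul (-(1 / 2) : ℝ)).congr_deriv
      (by simp)
  obtain ⟨c, ⟨hc0, hc1⟩, hc⟩ := exists_ratio_hasDerivAt_eq_ratio_slope _ _ zero_lt_one
    (fun t _ => (hF t).continuousAt.continuousWithinAt) (fun t _ => hF t) _ _
    (fun t _ => (hG t).continuousAt.continuousWithinAt) (fun t _ => hG t)
  refine ⟨a + c • v, ?_, ?_⟩
  · rw [segment_eq_image']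
    exact ⟨c, ⟨hc0.le, hc1.le⟩, rfl⟩
  · have hy : a + v = y := by simp [hv]
    simp only [one_smul, zero_smul, add_zero, hy] at hc
    apply mul_left_cancel₀ (sub_pos.2 hc1).ne'
    linear_combination -hc

/-- Difference between a function and its linear interpolant at points `p j`, controlled through
expansion about a fixed point `a` of the convex hull. -/
theorem abs_sub_sum_le_of_abs_fderiv_fderiv_sub_le {E ι : Type*} [NormedAddCommGroup E]
    [NormedSpace ℝ E] [Fintype ι] {g : E → ℝ} (hg : ContDiff ℝ 2 g) {s : Set E}
    (hs : Convex ℝ s) {a : E} (ha : a ∈ s) {p : ι → E} (hp : ∀ j, p j ∈ s) {c : ι → ℝ}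
    (hc : ∀ j, ∀ x ∈ s, ∀ z ∈ s, ∀ z' ∈ s,
      |fderiv ℝ (fderiv ℝ g) z (x - a) (x - a) -
        fderiv ℝ (fderiv ℝ g) z' (p j - a) (p j - a)| ≤ c j)
    {w : ι → ℝ} (hw : ∀ j, 0 ≤ w j) (hw1 : ∑ j, w j = 1) :
    |g (∑ j, w j • p j) - ∑ j, w j * g (p j)| ≤ (1 / 2) * ∑ j, w j * c j := by
  set x := ∑ j, w j • p j with hx
  have hxs : x ∈ s := hs.sum_mem (fun j _ => hw j) hw1 fun j _ => hp j
  obtain ⟨z, hz, hzx⟩ := exists_segment_taylor_two hg a x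
  choose z' hz' hzp using fun j => exists_segment_taylor_two hg a (p j)
  have hlin : fderiv ℝ g a (x - a) = ∑ j, w j * fderiv ℝ g a (p j - a) := by
    have : x - a = ∑ j, w j • (p j - a) := by
      simp [smul_sub, Finset.sum_sub_distrib, ← Finset.sum_smul, hw1, hx]
    simp [this]
  have key : g x - ∑ j, w j * g (p j) = (1 / 2) * ∑ j, w j *
      (fderiv ℝ (fderiv ℝ g) z (x - a) (x - a) -
        fderiv ℝ (fderiv ℝ g) (z' j) (p j - a) (p j - a)) := by
    simp_rw [hzp, mul_sub, mul_add, Finset.sum_sub_distrib, Finset.sum_add_distrib,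
      ← Finset.sum_mul, hw1]
    rw [hzx, hlin]
    simp_rw [mul_left_comm _ (1 / 2 : ℝ), ← Finset.mul_sum]
    ring
  rw [key, abs_mul, abs_of_pos (by norm_num : (0 : ℝ) < 1 / 2)]
  gcongr
  refine (Finset.abs_sum_le_sum_abs _ _).trans (Finset.sum_le_sum fun j _ => ?_)
  rw [abs_mul, abs_of_nonneg (hw j)]
  exact mul_le_mul_of_nonneg_left (hc j x hxs z (hs.segment_subset ha hxs hz) _
    (hs.segment_subset ha (hp j) (hz' j))) (hw j)

/-- A symmetric arrow matrix is positive semidefinite as soon as its Schur complement is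
nonnegative. -/
theorem posSemidef_fromBlocks_diagonal {ι : Type*} [Fintype ι] [DecidableEq ι] {a : ℝ}
    {b d : ι → ℝ} (hd : ∀ k, 0 < d k) (h : ∑ k, b k ^ 2 / d k ≤ a) :
    (Matrix.fromBlocks (Matrix.of fun _ _ : Unit => a) (Matrix.of fun (_ : Unit) k => b k)
      (Matrix.of fun k (_ : Unit) => b k) (Matrix.diagonal d)).PosSemidef := by
  refine .of_dotProduct_mulVec_nonneg ?_ fun x => ?_
  · refine Matrix.IsHermitian.fromBlocks ?_ ?_ ?_
    · ext; simp
    · ext; simp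
    · ext i j; simp [Matrix.diagonal_apply]; grind
  · set t := x (Sum.inl ())
    have hsq : ∑ k, (x (Sum.inr k) * (d k * x (Sum.inr k)) + 2 * (t * b k * x (Sum.inr k))
        + t ^ 2 * (b k ^ 2 / d k)) = ∑ k, (d k * x (Sum.inr k) + t * b k) ^ 2 / d k :=
      Finset.sum_congr rfl fun k _ => by
        have := (hd k).ne'
        field_simp
        ring
    have hnn : 0 ≤ ∑ k, (d k * x (Sum.inr k) + t * b k) ^ 2 / d k :=
      Finset.sum_nonneg fun k _ => div_nonneg (sq_nonneg _) (hd k).le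
    rw [← hsq] at hnn
    simp only [Finset.sum_add_distrib, ← Finset.mul_sum] at hnn
    have ht := mul_le_mul_of_nonneg_left h (sq_nonneg t)
    have hxform : star x ⬝ᵥ (Matrix.fromBlocks (Matrix.of fun _ _ : Unit => a)
        (Matrix.of fun (_ : Unit) k => b k) (Matrix.of fun k (_ : Unit) => b k)
        (Matrix.diagonal d) *ᵥ x) = t ^ 2 * a + 2 * ∑ k, t * b k * x (Sum.inr k)
          + ∑ k, x (Sum.inr k) * (d k * x (Sum.inr k)) := by
      simp [dotProduct, Matrix.mulVec, Matrix.diagonal_apply,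
        mul_add, Finset.sum_add_distrib, Finset.mul_sum]
      have hcross : ∑ k, 2 * (t * b k * x (Sum.inr k)) =
          ∑ k, x (Sum.inr k) * (b k * t) + ∑ k, t * (b k * x (Sum.inr k)) := by
        rw [← Finset.sum_add_distrib]
        exact Finset.sum_congr rfl fun k _ => by ring
      rw [hcross]
      ring
    rw [hxform]
    linarith

/-- Every point of the convex hull of a finite family is a convex combination of the family. -/
theorem exists_weights_of_mem_convexHull_range {E ι : Type*} [AddCommGroup E] [Module ℝ E]
    [Fintype ι] {p : ι → E} {x : E} (hx : x ∈ convexHull ℝ (Set.range p)) :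
    ∃ w : ι → ℝ, (∀ j, 0 ≤ w j) ∧ ∑ j, w j = 1 ∧ x = ∑ j, w j • p j := by
  classical
  obtain ⟨κ, _, v, z, hv0, hv1, hz, rfl⟩ := mem_convexHull_iff_exists_fintype.1 hx
  choose f hf using hz
  refine ⟨fun j => ∑ i with f i = j, v i, fun j => Finset.sum_nonneg fun i _ => hv0 i, ?_, ?_⟩
  · exact (Finset.sum_fiberwise _ f v).trans hv1
  · rw [← Finset.sum_fiberwise _ f]
    refine Finset.sum_congr rfl fun j _ => ?_
    rw [Finset.sum_smul]
    refine Finset.sum_congr rfl fun i hi => ?_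
    rw [← hf i, (Finset.mem_filter.1 hi).2]

/-- Corollary 1 of the paper, the LMI error bound obtained by Taylor
expansion about the fixed vertex `x₀`: with remainder-difference bounds `φ̃ⱼ`, `ζ̃ₖ`,
(i) `M(x) − Σⱼ λⱼ M(xⱼ) ⪯ Σⱼ λⱼ blockdiag(½φ̃ⱼ + ½ζ̃ᵀΠζ̃, ½Π⁻¹)` for every `x` in
the simplex with barycentric coordinates `λ`; and (ii) if the LMI plus its error
bound holds at every vertex, then `M(x) ⪯ 0` throughout the simplex. -/
theorem lmi_error_bound_vertex_expansion {n m : ℕ} (hn : 0 < n) (hm : 0 < m)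
    (φ : (Fin n → ℝ) → ℝ) (hφ : ContDiff ℝ 2 φ)
    (ζ : (Fin n → ℝ) → (Fin m → ℝ)) (hζ : ContDiff ℝ 2 ζ)
    (pts : Fin (n + 1) → (Fin n → ℝ))
    (hind : LinearIndependent ℝ (fun j : Fin n => pts j.succ - pts 0))
    (Pim : Matrix (Fin m) (Fin m) ℝ) (hPimDiag : Pim.IsDiag) (hPimPos : Pim.PosDef)
    (φtil : Fin (n + 1) → ℝ) (hφtil0 : ∀ j, 0 ≤ φtil j)
    (ζtil : Fin m → ℝ) (hζtil0 : ∀ k, 0 ≤ ζtil k)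
    (hφtil : ∀ j : Fin (n + 1), ∀ x ∈ convexHull ℝ (Set.range pts),
      ∀ z ∈ convexHull ℝ (Set.range pts), ∀ z' ∈ convexHull ℝ (Set.range pts),
      |fderiv ℝ (fderiv ℝ φ) z (x - pts 0) (x - pts 0) -
        fderiv ℝ (fderiv ℝ φ) z' (pts j - pts 0) (pts j - pts 0)| ≤ φtil j)
    (hζtil : ∀ (k : Fin m) (j : Fin (n + 1)), ∀ x ∈ convexHull ℝ (Set.range pts),
      ∀ z ∈ convexHull ℝ (Set.range pts), ∀ z' ∈ convexHull ℝ (Set.range pts),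
      |fderiv ℝ (fderiv ℝ (fun y => ζ y k)) z (x - pts 0) (x - pts 0) -
        fderiv ℝ (fderiv ℝ (fun y => ζ y k)) z' (pts j - pts 0) (pts j - pts 0)|
        ≤ ζtil k) :
    (∀ (x : Fin n → ℝ) (lam : Fin (n + 1) → ℝ),
      (∀ j, 0 ≤ lam j) → ∑ j, lam j = 1 → x = ∑ j, lam j • pts j →
      ((∑ j, lam j •
          Matrix.fromBlocks
            (Matrix.of fun _ _ : Unit =>
              (1 / 2) * φtil j + (1 / 2) * (ζtil ⬝ᵥ (Pim *ᵥ ζtil)))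
            0 0 ((1 / 2 : ℝ) • Pim⁻¹)) -
        (Mblock φ ζ x - ∑ j, lam j • Mblock φ ζ (pts j))).PosSemidef) ∧
    ((∀ j : Fin (n + 1),
        (-(Matrix.fromBlocks
            (Matrix.of fun _ _ : Unit =>
              φ (pts j) + (1 / 2) * φtil j + (1 / 2) * (ζtil ⬝ᵥ (Pim *ᵥ ζtil)))
            (Matrix.of fun (_ : Unit) k => ζ (pts j) k)
            (Matrix.of fun k (_ : Unit) => ζ (pts j) k)
            ((-1 : Matrix (Fin m) (Fin m) ℝ) + (1 / 2 : ℝ) • Pim⁻¹))).PosSemidef) →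
      ∀ x ∈ convexHull ℝ (Set.range pts), (-(Mblock φ ζ x)).PosSemidef) := by
  set d := Pim.diag
  have hPim : Pim = Matrix.diagonal d := hPimDiag.diagonal_diag.symm
  have hd (k : Fin m) : 0 < d k := hPimPos.diag_pos
  have hinv : Pim⁻¹ = Matrix.diagonal fun k => (d k)⁻¹ := by
    rw [hPim]
    refine Matrix.inv_eq_left_inv ?_
    simp [Matrix.diagonal_mul_diagonal, (hd _).ne']
  have hvert (j : Fin (n + 1)) : pts j ∈ convexHull ℝ (Set.range pts) :=
    subset_convexHull ℝ _ ⟨j, rfl⟩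
  have hbound : ∀ (x : Fin n → ℝ) (lam : Fin (n + 1) → ℝ),
      (∀ j, 0 ≤ lam j) → ∑ j, lam j = 1 → x = ∑ j, lam j • pts j →
      ((∑ j, lam j •
          Matrix.fromBlocks
            (Matrix.of fun _ _ : Unit =>
              (1 / 2) * φtil j + (1 / 2) * (ζtil ⬝ᵥ (Pim *ᵥ ζtil)))
            0 0 ((1 / 2 : ℝ) • Pim⁻¹)) -
        (Mblock φ ζ x - ∑ j, lam j • Mblock φ ζ (pts j))).PosSemidef := by
    rintro x lam hlam hlam1 rfl
    have hφerr := abs_sub_sum_le_of_abs_fderiv_fderiv_sub_le hφ (convex_convexHull ℝ _)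
      (hvert 0) hvert hφtil hlam hlam1
    have hζerr (k : Fin m) := abs_sub_sum_le_of_abs_fderiv_fderiv_sub_le
      (contDiff_pi.1 hζ k) (convex_convexHull ℝ _)
      (hvert 0) hvert (hζtil k) hlam hlam1
    simp only [← Finset.sum_mul, hlam1, one_mul] at hζerr
    set x := ∑ j, lam j • pts j
    have hpsd := posSemidef_fromBlocks_diagonal
      (a := (1 / 2) * ∑ j, lam j * φtil j + (1 / 2) * (ζtil ⬝ᵥ (Pim *ᵥ ζtil)) -
        (φ x - ∑ j, lam j * φ (pts j)))
      (b := fun k => -(ζ x k - ∑ j, lam j * ζ (pts j) k))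
      (d := fun k => (1 / 2) * (d k)⁻¹) (fun k => by have := hd k; positivity) (by
        have hquad : (1 / 2) * (ζtil ⬝ᵥ (Pim *ᵥ ζtil))
            = ∑ k, ((1 / 2) * ζtil k) ^ 2 / ((1 / 2) * (d k)⁻¹) := by
          rw [hPim, dotProduct, Finset.mul_sum]
          refine Finset.sum_congr rfl fun k _ => ?_
          have := (hd k).ne'
          rw [Matrix.mulVec_diagonal]
          field_simp
        have hsum : ∑ k, (-(ζ x k - ∑ j, lam j * ζ (pts j) k)) ^ 2 / ((1 / 2) * (d k)⁻¹)
            ≤ ∑ k, ((1 / 2) * ζtil k) ^ 2 / ((1 / 2) * (d k)⁻¹) := by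
          refine Finset.sum_le_sum fun k _ => ?_
          have := hd k
          rw [neg_sq]
          gcongr ?_ / _
          exact sq_le_sq.2 ((hζerr k).trans (le_abs_self _))
        linarith [(abs_le.1 hφerr).2])
    convert hpsd using 1
    ext (i | i) (j | j)
    · simp [Matrix.sum_apply, Mblock, mul_add, Finset.sum_add_distrib, ← Finset.sum_mul, hlam1,
        Finset.mul_sum, mul_left_comm]
    · simp [Matrix.sum_apply, Mblock]
    · simp [Matrix.sum_apply, Mblock]
    · simp [Matrix.sum_apply, Mblock, ← Finset.sum_mul, hlam1, hinv, Matrix.diagonal_apply]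
  refine ⟨hbound, fun hver x hx => ?_⟩
  obtain ⟨lam, hlam, hlam1, hxlam⟩ := exists_weights_of_mem_convexHull_range hx
  convert (hbound x lam hlam hlam1 hxlam).add
    (Matrix.posSemidef_sum Finset.univ fun j _ => (hver j).smul (hlam j)) using 1
  have hsplit (j : Fin (n + 1)) : Matrix.fromBlocks
      (Matrix.of fun _ _ : Unit =>
        φ (pts j) + (1 / 2) * φtil j + (1 / 2) * (ζtil ⬝ᵥ (Pim *ᵥ ζtil)))
      (Matrix.of fun (_ : Unit) k => ζ (pts j) k)
      (Matrix.of fun k (_ : Unit) => ζ (pts j) k)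
      ((-1 : Matrix (Fin m) (Fin m) ℝ) + (1 / 2 : ℝ) • Pim⁻¹) =
      Mblock φ ζ (pts j) + Matrix.fromBlocks
        (Matrix.of fun _ _ : Unit =>
          (1 / 2) * φtil j + (1 / 2) * (ζtil ⬝ᵥ (Pim *ᵥ ζtil)))
        0 0 ((1 / 2 : ℝ) • Pim⁻¹) := by
    rw [Mblock, Matrix.fromBlocks_add, add_zero, add_zero]
    congr 1
    ext
    simp [add_assoc]
  simp_rw [hsplit, smul_neg, smul_add, Finset.sum_neg_distrib, Finset.sum_add_distrib]
  abel
end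

section
/- Let k₁ > 0, k₂ > 0, and B, C, D, a, b, P ∈ ℝ with P > 0. Suppose the symmetric 2×2 matrix [[−k₂P + C², ½PB + CD − C·(a+b)/2], [½PB + CD − C·(a+b)/2, ab + D² − (a+b)D]] is negative semidefinite. Then for every x ∈ [−1, 1] and every u ∈ ℝ, setting y = Cx + Du, one has P·x·( k₁x³ − (k₁+k₂)x + Bu ) ≤ −y² + (a+b)·y·u − ab·u². -/
open Matrix

/-- the lemma of Appendix C of the paper, analytical conic bound for
the scalar system `ẋ = k₁x³ − (k₁+k₂)x + Bu`, `y = Cx + Du`: if the 2×2 LMI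
`[[−k₂P + C², ½PB + CD − C(a+b)/2], [∗, ab + D² − (a+b)D]] ⪯ 0` holds with `P > 0`,
then the pointwise conic dissipation inequality
`P x (k₁x³ − (k₁+k₂)x + Bu) ≤ −y² + (a+b)yu − ab u²` holds for all `x ∈ [−1,1]`
and all `u ∈ ℝ`. -/
theorem conic_dissipation_scalar (k₁ k₂ B C D a b P : ℝ)
    (hk₁ : 0 < k₁) (hk₂ : 0 < k₂) (hP : 0 < P)
    (hM : (-(!![-k₂ * P + C ^ 2, (1 / 2) * P * B + C * D - C * ((a + b) / 2);
        (1 / 2) * P * B + C * D - C * ((a + b) / 2),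
        a * b + D ^ 2 - (a + b) * D])).PosSemidef) :
    ∀ x ∈ Set.Icc (-1 : ℝ) 1, ∀ u : ℝ,
      P * x * (k₁ * x ^ 3 - (k₁ + k₂) * x + B * u) ≤
        -(C * x + D * u) ^ 2 + (a + b) * (C * x + D * u) * u - a * b * u ^ 2 := by
  rintro x ⟨hx₁, hx₂⟩ u
  have hquad := hM.dotProduct_mulVec_nonneg ![x, u]
  simp [Matrix.mulVec, dotProduct, Fin.sum_univ_two] at hquad
  have hx : 0 ≤ x ^ 2 * (1 - x ^ 2) :=
    mul_nonneg (sq_nonneg x) (by nlinarith)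
  have hPk : 0 ≤ P * k₁ * (x ^ 2 * (1 - x ^ 2)) := by positivity
  linarith
end
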